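/- arXiv:0805.2295 — 3 statements merged into one kernel-verified Lean document; each statement's English description precedes it below -/
import Mathlib

section
/- Let f be a rational function of degree d which does not map the real line entirely into ℝ ∪ {∞}. Then the set {x ∈ ℝ : f(x) ∈ ℝ} has at most 2d elements. -/
open Polynomial ComplexConjugate in
/-- Evaluation at a real point of the polynomial with conjugated coefficients. -/
theorem eval_ofReal_map_conj (p : ℂ[X]) (x : ℝ) :
    (p.map (starRingEnd ℂ)).eval (x : ℂ) = conj (p.eval (x : ℂ)) := by
  simpa using eval_map_apply (p := p) (f := starRingEnd ℂ) (x : ℂ)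

open ComplexConjugate in
theorem div_im_eq_zero_iff {a b : ℂ} (hb : b ≠ 0) :
    (a / b).im = 0 ↔ a * conj b - conj a * b = 0 := by
  have hb' : conj b ≠ 0 := by simpa using hb
  rw [← Complex.conj_eq_iff_im, map_div₀, div_eq_div_iff hb' hb, sub_eq_zero, eq_comm]


/-- For a rational function `f = p/q` of degree `d` (with `p, q` coprime) which does not map
the real line entirely into `ℝ ∪ {∞}`, the set `{x ∈ ℝ : f(x) ∈ ℝ}` has at most `2d`
elements. (A point `x` with `q(x) = 0` maps to `∞ ∉ ℝ`.) -/
theorem real_points_of_rational_le (d : ℕ) (p q : Polynomial ℂ) (hq : q ≠ 0)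
    (hcop : IsCoprime p q) (hdeg : max p.natDegree q.natDegree = d)
    (hnotreal : ¬ ∀ x : ℝ, q.eval (x : ℂ) = 0 ∨ (p.eval (x : ℂ) / q.eval (x : ℂ)).im = 0) :
    {x : ℝ | q.eval (x : ℂ) ≠ 0 ∧ (p.eval (x : ℂ) / q.eval (x : ℂ)).im = 0}.encard ≤ 2 * d := by
  set N : Polynomial ℂ := p * q.map (starRingEnd ℂ) - p.map (starRingEnd ℂ) * q with hN
  have key (x : ℝ) (hx : q.eval (x : ℂ) ≠ 0) :
      (p.eval (x : ℂ) / q.eval (x : ℂ)).im = 0 ↔ N.eval (x : ℂ) = 0 := by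
    rw [div_im_eq_zero_iff hx, hN]
    simp [eval_ofReal_map_conj]
  have hN0 : N ≠ 0 := by
    intro h
    refine hnotreal fun x => or_iff_not_imp_left.2 fun hx => (key x hx).2 ?_
    simp [h]
  have hdegN : N.natDegree ≤ 2 * d := by
    have hp : p.natDegree ≤ d := hdeg ▸ le_max_left _ _
    have hq' : q.natDegree ≤ d := hdeg ▸ le_max_right _ _
    rw [two_mul]
    exact Polynomial.natDegree_sub_le_of_le
      (Polynomial.natDegree_mul_le_of_le hp (Polynomial.natDegree_map_le.trans hq'))
      (Polynomial.natDegree_mul_le_of_le (Polynomial.natDegree_map_le.trans hp) hq') |>.trans_eq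
        (max_self _)
  calc _ = ((fun x : ℝ => (x : ℂ)) '' {x : ℝ | q.eval (x : ℂ) ≠ 0 ∧
          (p.eval (x : ℂ) / q.eval (x : ℂ)).im = 0}).encard :=
        (Complex.ofReal_injective.encard_image _).symm
    _ ≤ (N.roots.toFinset : Set ℂ).encard := by
        refine Set.encard_le_encard ?_
        rintro _ ⟨x, ⟨hx, hx'⟩, rfl⟩
        simpa [hN0] using (key x hx).1 hx'
    _ ≤ 2 * d := by
        rw [Set.encard_coe_eq_coe_finsetCard]
        exact_mod_cast (Multiset.toFinset_card_le _).trans (N.card_roots'.trans hdegN)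
end

section
/- Let Γ ⊂ ℂ be a rectifiable curve (the image of a continuous map of finite length from a compact interval) with the property that Γ intersects every vertical line {z : Re z = x} and every horizontal line {z : Im z = y} in at most n points. Then the length of Γ is at most n·(|π_x(Γ)| + |π_y(Γ)|), where π_x and π_y denote the orthogonal projections onto the real and imaginary axes and |·| denotes one-dimensional Lebesgue measure of the projection. -/
open MeasureTheory

open Set Function NNReal ENNReal

/-- A real function which is close to a linear function of nonzero slope on `S` is injective on
`S` and shrinks the volume at most by the corresponding factor. -/
theorem injOn_and_mul_volume_le_of_abs_sub_le {u : ℝ → ℝ} {S : Set ℝ} {c δ : ℝ} (hδ : δ < |c|)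
    (hu : ∀ s ∈ S, ∀ t ∈ S, |u s - u t - c * (s - t)| ≤ δ * |s - t|) :
    InjOn u S ∧ ENNReal.ofReal (|c| - δ) * volume S ≤ volume (u '' S) := by
  have hpos : 0 < |c| - δ := sub_pos.2 hδ
  have anti : ∀ s ∈ S, ∀ t ∈ S, (|c| - δ) * |s - t| ≤ |u s - u t| := by
    intro s hs t ht
    have h1 := hu s hs t ht
    have h2 := abs_sub_abs_le_abs_sub (c * (s - t)) (u s - u t)
    rw [abs_sub_comm (c * (s - t)), abs_mul] at h2
    linarith
  have inj : InjOn u S := by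
    intro s hs t ht hst
    have h := anti s hs t ht
    rw [hst, sub_self, abs_zero] at h
    have h0 : |s - t| ≤ 0 := nonpos_of_mul_nonpos_right h hpos
    exact sub_eq_zero.1 (abs_nonpos_iff.1 h0)
  refine ⟨inj, ?_⟩
  have hlip : LipschitzOnWith (Real.toNNReal (|c| - δ))⁻¹ (invFunOn u S) (u '' S) := by
    refine LipschitzOnWith.of_dist_le_mul ?_
    rintro _ ⟨s, hs, rfl⟩ _ ⟨t, ht, rfl⟩
    rw [inj.leftInvOn_invFunOn hs, inj.leftInvOn_invFunOn ht, Real.dist_eq, Real.dist_eq,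
      NNReal.coe_inv, Real.coe_toNNReal _ hpos.le, ← div_eq_inv_mul, le_div_iff₀' hpos]
    exact anti s hs t ht
  have h := hlip.hausdorffMeasure_image_le zero_le_one
  rw [inj.leftInvOn_invFunOn.image_image, hausdorffMeasure_real, ENNReal.rpow_one,
    ENNReal.coe_inv (by simpa using hδ)] at h
  exact (ENNReal.mul_le_iff_le_inv (by simpa using hδ) ENNReal.coe_ne_top).2 h

/-- If every fibre of `u` in `A` has at most `n` points, then the images of disjoint subsets of
`A` have total volume at most `n` times the volume of the image of `A`. -/
theorem tsum_volume_image_le {u : ℝ → ℝ} {A : Set ℝ} {E : ℕ → Set ℝ} {n : ℕ}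
    (hdisj : Pairwise (Disjoint on E)) (hEA : ∀ j, E j ⊆ A)
    (hmeas : ∀ j, MeasurableSet (u '' E j)) (hfib : ∀ y, {t ∈ A | u t = y}.encard ≤ n) :
    ∑' j, volume (u '' E j) ≤ n * volume (u '' A) := by
  classical
  rw [← measure_toMeasurable (u '' A)]
  calc ∑' j, volume (u '' E j)
      = ∫⁻ y, ∑' j, (u '' E j).indicator 1 y := by
        rw [lintegral_tsum fun j => (measurable_one.indicator (hmeas j)).aemeasurable]
        exact tsum_congr fun j => (lintegral_indicator_one (hmeas j)).symm
    _ ≤ ∫⁻ y, (toMeasurable volume (u '' A)).indicator (fun _ => (n : ℝ≥0∞)) y := by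
        refine lintegral_mono fun y => ?_
        by_cases hy : y ∈ toMeasurable volume (u '' A)
        · rw [indicator_of_mem hy, ENNReal.tsum_eq_iSup_sum]
          refine iSup_le fun F => ?_
          let G := F.filter fun j => y ∈ u '' E j
          have hG : ∀ j ∈ G, ∃ t ∈ E j, u t = y := fun j hj => (Finset.mem_filter.1 hj).2
          choose! w hwE hw using hG
          have hcard : ((G : Set ℕ)).encard ≤ n := by
            refine (encard_le_encard_of_injOn (f := w) ?_ ?_).trans (hfib y)
            · exact fun j hj => ⟨hEA j (hwE j hj), hw j hj⟩
            · intro i hi j hj hij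
              by_contra hne
              exact disjoint_left.1 (hdisj hne) (hwE i hi) (hij ▸ hwE j hj)
          rw [encard_coe_eq_coe_finsetCard, Nat.cast_le] at hcard
          have hsum : ∑ j ∈ F, (u '' E j).indicator (1 : ℝ → ℝ≥0∞) y = (G.card : ℝ≥0∞) := by
            simp only [indicator_apply, Pi.one_apply, Finset.sum_boole, G]
          rw [hsum]
          exact_mod_cast hcard
        · rw [indicator_of_notMem hy]
          refine (ENNReal.tsum_eq_zero.2 fun j => indicator_of_notMem (fun h => hy ?_) _).le
          exact subset_toMeasurable _ _ (image_mono (hEA j) h)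
    _ = n * volume (toMeasurable volume (u '' A)) :=
        lintegral_indicator_const (measurableSet_toMeasurable _ _) _

/-- If every fibre of `u` in `A` has at most `n` points and `u` is nearly linear with slope `c j`
on disjoint pieces `E j` of `A`, then `∑ |c j| |E j|` is almost bounded by `n |u(A)|`. -/
theorem tsum_abs_slope_mul_volume_le {u : ℝ → ℝ} (hucont : Continuous u) {A : Set ℝ}
    {E : ℕ → Set ℝ} {n : ℕ} (hdisj : Pairwise (Disjoint on E)) (hEA : ∀ j, E j ⊆ A)
    (hmeas : ∀ j, MeasurableSet (E j)) (hfib : ∀ y, {t ∈ A | u t = y}.encard ≤ n)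
    {c : ℕ → ℝ} {δ : ℝ} (hδ : 0 ≤ δ)
    (hu : ∀ j, ∀ s ∈ E j, ∀ t ∈ E j, |u s - u t - c j * (s - t)| ≤ δ * |s - t|) :
    ∑' j, ENNReal.ofReal |c j| * volume (E j) ≤
      n * volume (u '' A) + ENNReal.ofReal δ * volume A := by
  classical
  let E' : ℕ → Set ℝ := fun j => if δ < |c j| then E j else ∅
  have hE' : ∀ j, E' j ⊆ E j := fun j => by
    by_cases h : δ < |c j| <;> simp [E', h]
  have hmeas' : ∀ j, MeasurableSet (u '' E' j) := fun j => by
    by_cases h : δ < |c j|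
    · simp only [E', h, if_true]
      exact (hmeas j).image_of_continuousOn_injOn hucont.continuousOn
        (injOn_and_mul_volume_le_of_abs_sub_le h (hu j)).1
    · simp [E', h]
  have hterm : ∀ j, ENNReal.ofReal |c j| * volume (E j) ≤
      volume (u '' E' j) + ENNReal.ofReal δ * volume (E j) := fun j => by
    by_cases h : δ < |c j|
    · have h1 := (injOn_and_mul_volume_le_of_abs_sub_le h (hu j)).2
      simp only [E', h, if_true]
      calc ENNReal.ofReal |c j| * volume (E j)
          = ENNReal.ofReal (|c j| - δ) * volume (E j) + ENNReal.ofReal δ * volume (E j) := by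
            rw [← add_mul, ← ENNReal.ofReal_add (sub_pos.2 h).le hδ, sub_add_cancel]
        _ ≤ _ := by gcongr
    · refine le_add_left ?_
      gcongr
      exact not_lt.1 h
  calc ∑' j, ENNReal.ofReal |c j| * volume (E j)
      ≤ ∑' j, (volume (u '' E' j) + ENNReal.ofReal δ * volume (E j)) := ENNReal.tsum_le_tsum hterm
    _ = ∑' j, volume (u '' E' j) + ENNReal.ofReal δ * volume (⋃ j, E j) := by
        rw [ENNReal.tsum_add, ENNReal.tsum_mul_left, measure_iUnion hdisj hmeas]
    _ ≤ _ := by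
        gcongr
        · exact tsum_volume_image_le (fun i j h => (hdisj h).mono (hE' i) (hE' j))
            (fun j => (hE' j).trans (hEA j)) hmeas' hfib
        · exact iUnion_subset hEA

/-- The length of a Lipschitz image is bounded by the projections of the image, when the
coordinate functions take each value at most `n` times. -/
theorem hausdorffMeasure_image_le_of_encard_fiber_le {g : ℝ → ℂ} {K : ℝ≥0}
    (hg : LipschitzWith K g) {A : Set ℝ} (hA : MeasurableSet A) (hAfin : volume A ≠ ⊤) {n : ℕ}
    (hre : ∀ x, {t ∈ A | (g t).re = x}.encard ≤ n)
    (him : ∀ y, {t ∈ A | (g t).im = y}.encard ≤ n) :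
    μH[1] (g '' A) ≤
      n * (volume ((fun t => (g t).re) '' A) + volume ((fun t => (g t).im) '' A)) := by
  set D : Set ℝ := {t | DifferentiableAt ℝ g t}
  have hD : MeasurableSet D := measurableSet_of_differentiableAt ℝ g
  have key : ∀ δ : ℝ≥0, δ ≠ 0 → μH[1] (g '' A) ≤
      n * (volume ((fun t => (g t).re) '' A) + volume ((fun t => (g t).im) '' A)) +
        δ * (3 * volume A) := by
    intro δ hδ
    obtain ⟨t, L, htdisj, htmeas, hcov, happ, -⟩ :=
      exists_partition_approximatesLinearOn_of_hasFDerivWithinAt g (A ∩ D) (fderiv ℝ g)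
        (fun x hx => (DifferentiableAt.hasFDerivAt hx.2).hasFDerivWithinAt) (fun _ => δ)
        (fun _ => hδ)
    set E : ℕ → Set ℝ := fun j => (A ∩ D) ∩ t j
    have hEdisj : Pairwise (Disjoint on E) := fun i j h =>
      (htdisj h).mono inter_subset_right inter_subset_right
    have hEmeas : ∀ j, MeasurableSet (E j) := fun j => (hA.inter hD).inter (htmeas j)
    have hEA : ∀ j, E j ⊆ A := fun j => inter_subset_left.trans inter_subset_left
    have hL : ∀ j s, L j s = s * L j 1 := fun j s => by
      rw [← Complex.real_smul, ← map_smul, smul_eq_mul, mul_one]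
    have hE : ∀ j, ∀ s ∈ E j, ∀ r ∈ E j,
        ‖g s - g r - (s - r : ℝ) * L j 1‖ ≤ δ * |s - r| := fun j s hs r hr => by
      have h := happ j s hs r hr
      rwa [hL, Real.norm_eq_abs] at h
    have hsumre := tsum_abs_slope_mul_volume_le (Complex.continuous_re.comp hg.continuous)
      hEdisj hEA hEmeas hre (c := fun j => (L j 1).re) δ.coe_nonneg fun j s hs r hr => by
        refine le_trans (le_of_eq ?_) ((Complex.abs_re_le_norm _).trans (hE j s hs r hr))
        simp only [comp_apply, Complex.sub_re, Complex.re_ofReal_mul]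
        ring_nf
    have hsumim := tsum_abs_slope_mul_volume_le (Complex.continuous_im.comp hg.continuous)
      hEdisj hEA hEmeas him (c := fun j => (L j 1).im) δ.coe_nonneg fun j s hs r hr => by
        refine le_trans (le_of_eq ?_) ((Complex.abs_im_le_norm _).trans (hE j s hs r hr))
        simp only [comp_apply, Complex.sub_im, Complex.im_ofReal_mul]
        ring_nf
    rw [ENNReal.ofReal_coe_nnreal] at hsumre hsumim
    have hnull : μH[1] (g '' (A \ D)) = 0 := by
      have h := (hg.lipschitzOnWith (s := A \ D)).hausdorffMeasure_image_le zero_le_one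
      have h0 : volume (A \ D) = 0 :=
        measure_mono_null (fun x hx => hx.2) hg.ae_differentiableAt_real
      rw [hausdorffMeasure_real, h0, mul_zero] at h
      exact le_antisymm h zero_le
    have hpiece : ∀ j, μH[1] (g '' E j) ≤ ENNReal.ofReal |(L j 1).re| * volume (E j) +
        ENNReal.ofReal |(L j 1).im| * volume (E j) + δ * volume (E j) := fun j => by
      have hlip : LipschitzOnWith (‖L j 1‖₊ + δ) g (E j) := by
        refine LipschitzOnWith.of_dist_le_mul fun s hs r hr => ?_
        rw [dist_eq_norm, Real.dist_eq, NNReal.coe_add, coe_nnnorm, add_mul]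
        have h1 := hE j s hs r hr
        have h2 := norm_sub_norm_le (g s - g r) ((s - r : ℝ) * L j 1)
        rw [norm_mul, Complex.norm_real, Real.norm_eq_abs] at h2
        linarith
      have h := hlip.hausdorffMeasure_image_le zero_le_one
      rw [hausdorffMeasure_real, ENNReal.rpow_one, ENNReal.coe_add, add_mul] at h
      refine h.trans ?_
      rw [← add_mul (ENNReal.ofReal _), ← ENNReal.ofReal_add (abs_nonneg _) (abs_nonneg _)]
      gcongr
      rw [← ENNReal.ofReal_coe_nnreal, coe_nnnorm]
      exact ENNReal.ofReal_le_ofReal (Complex.norm_le_abs_re_add_abs_im _)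
    have hsub : g '' A ⊆ g '' (A \ D) ∪ ⋃ j, g '' E j := by
      rw [← image_iUnion, ← image_union]
      refine image_mono fun x hx => ?_
      by_cases hxD : x ∈ D
      · obtain ⟨j, hj⟩ := mem_iUnion.1 (hcov ⟨hx, hxD⟩)
        exact Or.inr (mem_iUnion.2 ⟨j, ⟨hx, hxD⟩, hj⟩)
      · exact Or.inl ⟨hx, hxD⟩
    calc μH[1] (g '' A)
        ≤ μH[1] (g '' (A \ D)) + μH[1] (⋃ j, g '' E j) :=
          (measure_mono hsub).trans (measure_union_le _ _)
      _ ≤ ∑' j, μH[1] (g '' E j) := by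
          rw [hnull, zero_add]
          exact measure_iUnion_le _
      _ ≤ ∑' j, (ENNReal.ofReal |(L j 1).re| * volume (E j) +
            ENNReal.ofReal |(L j 1).im| * volume (E j) + δ * volume (E j)) :=
          ENNReal.tsum_le_tsum hpiece
      _ = ∑' j, ENNReal.ofReal |(L j 1).re| * volume (E j) +
            ∑' j, ENNReal.ofReal |(L j 1).im| * volume (E j) + δ * volume (⋃ j, E j) := by
          rw [ENNReal.tsum_add, ENNReal.tsum_add, ENNReal.tsum_mul_left,
            measure_iUnion hEdisj hEmeas]
      _ ≤ (n * volume ((fun t => (g t).re) '' A) + δ * volume A) +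
            (n * volume ((fun t => (g t).im) '' A) + δ * volume A) + δ * volume A := by
          gcongr
          · exact hsumre
          · exact hsumim
          · exact iUnion_subset hEA
      _ = _ := by ring
  refine ENNReal.le_of_forall_pos_le_add fun ε hε _ => ?_
  obtain ⟨δ, hδ, hlt⟩ := ENNReal.exists_nnreal_pos_mul_lt
    (ENNReal.mul_ne_top ENNReal.ofNat_ne_top hAfin : 3 * volume A ≠ ⊤)
    (ENNReal.coe_ne_zero.2 hε.ne')
  exact (key δ hδ.ne').trans (by gcongr)

/-- A curve of finite length has a Lipschitz parametrization by a compact set of reals. -/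
theorem exists_lipschitzWith_image_eq {γ : ℝ → ℂ} {a b : ℝ} (hab : a ≤ b)
    (hcont : ContinuousOn γ (Icc a b)) (hfin : BoundedVariationOn γ (Icc a b)) :
    ∃ (K : ℝ≥0) (g : ℝ → ℂ) (T : Set ℝ),
      LipschitzWith K g ∧ IsCompact T ∧ g '' T = γ '' Icc a b := by
  set V : ℝ → ℝ := variationOnFromTo γ (Icc a b) a
  have haI : a ∈ Icc a b := left_mem_Icc.2 hab
  have hloc : LocallyBoundedVariationOn γ (Icc a b) := hfin.locallyBoundedVariationOn
  have hle : ∀ s ∈ Icc a b, ∀ t ∈ Icc a b, s ≤ t → dist (γ s) (γ t) ≤ dist (V s) (V t) := by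
    intro s hs t ht hst
    have h1 : V t - V s = variationOnFromTo γ (Icc a b) s t := by
      simp only [V]
      rw [← variationOnFromTo.add hloc haI hs ht, add_sub_cancel_left]
    rw [dist_comm (V s), Real.dist_eq, h1]
    refine le_trans ?_ (le_abs_self _)
    rw [variationOnFromTo.eq_of_le γ _ hst, dist_edist]
    exact ENNReal.toReal_mono (hloc s t hs ht)
      (eVariationOn.edist_le γ ⟨hs, le_rfl, hst⟩ ⟨ht, hst, le_rfl⟩)
  have hdist : ∀ s ∈ Icc a b, ∀ t ∈ Icc a b, dist (γ s) (γ t) ≤ dist (V s) (V t) := by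
    intro s hs t ht
    rcases le_total s t with h | h
    · exact hle s hs t ht h
    · rw [dist_comm, dist_comm (V s)]
      exact hle t ht s hs h
  have hinv : ∀ v ∈ V '' Icc a b, invFunOn V (Icc a b) v ∈ Icc a b ∧
      V (invFunOn V (Icc a b) v) = v := fun v hv => ⟨invFunOn_mem hv, invFunOn_eq hv⟩
  have hlip : LipschitzOnWith 1 (γ ∘ invFunOn V (Icc a b)) (V '' Icc a b) := by
    refine LipschitzOnWith.of_dist_le_mul fun v hv w hw => ?_
    have h := hdist _ (hinv v hv).1 _ (hinv w hw).1
    rwa [(hinv v hv).2, (hinv w hw).2, ← one_mul (dist v w)] at h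
  obtain ⟨g, hg, hEq⟩ := hlip.extend_finite_dimension
  have hgV : ∀ s ∈ Icc a b, g (V s) = γ s := fun s hs => by
    have hv := mem_image_of_mem V hs
    rw [← hEq hv, comp_apply]
    have h := hdist _ (hinv _ hv).1 s hs
    rw [(hinv _ hv).2, dist_self] at h
    exact dist_le_zero.1 h
  have himage : g '' (V '' Icc a b) = γ '' Icc a b := by
    rw [image_image]
    exact image_congr hgV
  have hbdd : Bornology.IsBounded (V '' Icc a b) :=
    (Metric.isBounded_Icc (V a) (V b)).subset <| by
      rintro _ ⟨t, ht, rfl⟩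
      have hmono := variationOnFromTo.monotoneOn hloc haI
      exact ⟨hmono haI ht ht.1, hmono ht (right_mem_Icc.2 hab) ht.2⟩
  refine ⟨_, g, closure (V '' Icc a b), hg, hbdd.isCompact_closure, ?_⟩
  refine Subset.antisymm ?_ (himage ▸ image_mono subset_closure)
  refine (image_closure_subset_closure_image hg.continuous).trans ?_
  rw [himage, (isCompact_Icc.image_of_continuousOn hcont).isClosed.closure_eq]

/-- A continuous image of a compact set of reals is an injective image of a Borel subset. -/
theorem IsCompact.exists_measurableSet_injOn_image_eq {X : Type*} [TopologicalSpace X] [T2Space X]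
    {g : ℝ → X} (hg : Continuous g) {T : Set ℝ} (hT : IsCompact T) :
    ∃ A ⊆ T, MeasurableSet A ∧ InjOn g A ∧ g '' A = g '' T := by
  set A : Set ℝ := {t ∈ T | ∀ s ∈ T, s < t → g s ≠ g t}
  refine ⟨A, sep_subset _ _, ?_, ?_, ?_⟩
  · let P : ℕ → Set (ℝ × ℝ) := fun k =>
      T ×ˢ T ∩ {p | p.1 + 1 / ((k : ℝ) + 1) ≤ p.2 ∧ g p.1 = g p.2}
    have hP : ∀ k, IsCompact (P k) := fun k =>
      (hT.prod hT).inter_right <|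
        IsClosed.and (isClosed_le (by fun_prop) (by fun_prop))
          (isClosed_eq (by fun_prop) (by fun_prop))
    have hAeq : A = T \ ⋃ k, Prod.snd '' P k := by
      ext t
      constructor
      · rintro ⟨ht, hmin⟩
        refine ⟨ht, fun hmem => ?_⟩
        obtain ⟨k, ⟨s, r⟩, ⟨⟨hs, -⟩, hle, heq⟩, rfl⟩ := mem_iUnion.1 hmem
        have hk : 0 < 1 / ((k : ℝ) + 1) := Nat.one_div_pos_of_nat
        exact hmin s hs (by simp only at hle ⊢; linarith) heq
      · rintro ⟨ht, hnot⟩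
        refine ⟨ht, fun s hs hst heq => hnot ?_⟩
        obtain ⟨k, hk⟩ := exists_nat_one_div_lt (sub_pos.2 hst)
        exact mem_iUnion.2 ⟨k, (s, t), ⟨⟨hs, ht⟩, by simp only; linarith, heq⟩, rfl⟩
    rw [hAeq]
    exact hT.measurableSet.diff
      (MeasurableSet.iUnion fun k => ((hP k).image continuous_snd).measurableSet)
  · intro s hs t ht hst
    rcases lt_trichotomy s t with h | h | h
    · exact absurd hst (ht.2 s hs.1 h)
    · exact h
    · exact absurd hst.symm (hs.2 t ht.1 h)
  · refine Subset.antisymm (image_mono (sep_subset _ _)) ?_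
    rintro _ ⟨t, ht, rfl⟩
    obtain ⟨s, ⟨hs, hst⟩, hmin⟩ :=
      (hT.inter_right (isClosed_eq hg (continuous_const (y := g t)))).exists_isLeast ⟨t, ht, rfl⟩
    refine ⟨s, ⟨hs, fun r hr hrs heq => ?_⟩, hst⟩
    exact not_le.2 hrs (hmin ⟨hr, heq.trans hst⟩)

open MeasureTheory

/-- **Lemma 2.** If a rectifiable curve `Γ` (the image of a continuous map of finite length
on a compact interval) intersects every vertical and every horizontal line in at most `n`
points, then `length(Γ) ≤ n · (|π_x(Γ)| + |π_y(Γ)|)`, where `π_x, π_y` are the orthogonal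
projections onto the real and imaginary axes and `|·|` is Lebesgue measure. -/
theorem length_le_of_proj (n : ℕ) (a b : ℝ) (γ : ℝ → ℂ)
    (hcont : ContinuousOn γ (Set.Icc a b)) (hfin : eVariationOn γ (Set.Icc a b) ≠ ⊤)
    (Γ : Set ℂ) (hΓ : Γ = γ '' Set.Icc a b)
    (hvert : ∀ x : ℝ, {z ∈ Γ | z.re = x}.encard ≤ n)
    (hhoriz : ∀ y : ℝ, {z ∈ Γ | z.im = y}.encard ≤ n) :
    μH[1] Γ ≤ n * (volume (Complex.re '' Γ) + volume (Complex.im '' Γ)) := by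
  rcases lt_or_ge b a with hab | hab
  · simp [hΓ, Set.Icc_eq_empty hab.not_ge]
  obtain ⟨K, g, T, hg, hT, hgT⟩ := exists_lipschitzWith_image_eq hab hcont hfin
  obtain ⟨A, hAT, hA, hinj, hgA⟩ := hT.exists_measurableSet_injOn_image_eq hg.continuous
  have hAΓ : g '' A = Γ := by rw [hgA, hgT, hΓ]
  have hfiber : ∀ p : ℂ → Prop, {z ∈ Γ | p z}.encard ≤ n → {t ∈ A | p (g t)}.encard ≤ n :=
    fun p hp => by
      refine (Set.encard_le_encard_of_injOn (f := g) (fun t ht => ?_)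
        (hinj.mono (Set.sep_subset _ _))).trans hp
      exact ⟨hAΓ ▸ Set.mem_image_of_mem g ht.1, ht.2⟩
  have h := hausdorffMeasure_image_le_of_encard_fiber_le hg hA
    (measure_ne_top_of_subset hAT hT.measure_lt_top.ne)
    (fun x => hfiber (fun z => z.re = x) (hvert x))
    (fun y => hfiber (fun z => z.im = y) (hhoriz y))
  rwa [← Set.image_image Complex.re g, ← Set.image_image Complex.im g, hAΓ] at h
end

section
/- Let E ⊂ ℂ be a compact connected set and d ≥ 1 such that E intersects almost every affine real line in at most 2d points (with respect to the kinematic measure dx dθ on lines {z : Re(z e^{−iθ}) = x}). Then the length of E is at most d times the perimeter of the convex hull of E. -/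
open MeasureTheory

/-- The coordinate `Re(z·e^{-iθ})`, constant along the lines with normal direction `θ`. -/
noncomputable def lineProj (θ : ℝ) : ℂ →L[ℝ] ℝ :=
  Real.cos θ • Complex.reCLM + Real.sin θ • Complex.imCLM

lemma lineProj_apply (θ : ℝ) (z : ℂ) :
    lineProj θ z = Real.cos θ * z.re + Real.sin θ * z.im := by
  simp [lineProj]

lemma re_mul_exp_eq_lineProj (θ : ℝ) (z : ℂ) :
    (z * Complex.exp (-(θ : ℂ) * Complex.I)).re = lineProj θ z := by
  rw [lineProj_apply, ← Complex.ofReal_neg, Complex.exp_mul_I, ← Complex.ofReal_cos,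
    ← Complex.ofReal_sin, Real.cos_neg, Real.sin_neg]
  simp [-Complex.ofReal_cos, -Complex.ofReal_sin, mul_comm]

lemma lineProj_eq_norm_mul_cos (θ : ℝ) (z : ℂ) :
    lineProj θ z = ‖z‖ * Real.cos (θ - z.arg) := by
  rw [lineProj_apply, Real.cos_sub]
  linear_combination -Real.cos θ * Complex.norm_mul_cos_arg z -
    Real.sin θ * Complex.norm_mul_sin_arg z

lemma abs_lineProj_le (θ : ℝ) (z : ℂ) : |lineProj θ z| ≤ ‖z‖ := by
  rw [lineProj_eq_norm_mul_cos, abs_mul, abs_norm]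
  exact mul_le_of_le_one_right (norm_nonneg z) (Real.abs_cos_le_one _)

lemma integral_abs_cos_sub (φ : ℝ) : ∫ θ in (0 : ℝ)..Real.pi, |Real.cos (θ - φ)| = 2 := by
  have hper : Function.Periodic (fun θ ↦ |Real.cos θ|) Real.pi := fun θ ↦ by
    simp [Real.cos_add_pi]
  rw [intervalIntegral.integral_comp_sub_right (fun θ ↦ |Real.cos θ|) φ]
  have h := hper.intervalIntegral_add_eq (0 - φ) (-(Real.pi / 2))
  rw [show (0 : ℝ) - φ + Real.pi = Real.pi - φ by ring,
    show -(Real.pi / 2) + Real.pi = Real.pi / 2 by ring] at h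
  rw [h]
  have hpos : (-(Real.pi / 2)) ≤ Real.pi / 2 := by linarith [Real.pi_pos]
  rw [intervalIntegral.integral_congr (g := Real.cos)]
  · rw [integral_cos]; simp; norm_num
  · intro θ hθ
    rw [Set.uIcc_of_le hpos] at hθ
    exact abs_of_nonneg (Real.cos_nonneg_of_mem_Icc hθ)

lemma lintegral_abs_lineProj (z : ℂ) :
    ∫⁻ θ in Set.Ico 0 Real.pi, ENNReal.ofReal |lineProj θ z| = 2 * ENNReal.ofReal ‖z‖ := by
  have hcont : Continuous fun θ ↦ |lineProj θ z| := by
    simp only [lineProj_apply]; fun_prop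
  rw [Measure.restrict_congr_set Ico_ae_eq_Ioc, ← ofReal_integral_eq_lintegral_ofReal,
    ← intervalIntegral.integral_of_le Real.pi_pos.le]
  · simp_rw [lineProj_eq_norm_mul_cos, abs_mul, abs_norm]
    rw [intervalIntegral.integral_const_mul, integral_abs_cos_sub, mul_comm,
      ENNReal.ofReal_mul (by norm_num)]
    simp
  · exact (hcont.integrableOn_Icc).mono_set Set.Ioc_subset_Icc_self
  · exact Filter.Eventually.of_forall fun _ ↦ abs_nonneg _

lemma IsCompact.connectedComponentIn {X : Type*} [TopologicalSpace X]
    {s : Set X} (hs : IsCompact s) (x : X) : IsCompact (connectedComponentIn s x) := by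
  by_cases hx : x ∈ s
  · have := isCompact_iff_compactSpace.mp hs
    rw [connectedComponentIn_eq_image hx]
    exact isClosed_connectedComponent.isCompact.image continuous_subtype_val
  · simp [connectedComponentIn_eq_empty hx]

/-- The closed cell cut out by the functions `f i`, nonnegative for `i ∈ s` and nonpositive
for `i ∉ s`. -/
def signCell {X ι : Type*} (f : ι → X → ℝ) (s : Set ι) : Set X :=
  {z | ∀ i, (i ∈ s → 0 ≤ f i z) ∧ (i ∉ s → f i z ≤ 0)}

lemma isClosed_signCell {X ι : Type*} [TopologicalSpace X] {f : ι → X → ℝ}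
    (hf : ∀ i, Continuous (f i)) (s : Set ι) : IsClosed (signCell f s) := by
  have : signCell f s =
      ⋂ i, ({z | i ∈ s → 0 ≤ f i z} ∩ {z | i ∉ s → f i z ≤ 0}) := by
    ext z; simp [signCell]
  rw [this]
  refine isClosed_iInter fun i ↦ ?_
  by_cases hi : i ∈ s
  · simpa [hi] using isClosed_le continuous_const (hf i)
  · simpa [hi] using isClosed_le (hf i) continuous_const

lemma mem_signCell_setOf {X ι : Type*} (f : ι → X → ℝ) (z : X) :
    z ∈ signCell f {i | 0 ≤ f i z} :=
  fun _ ↦ ⟨id, fun h ↦ (not_le.mp h).le⟩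

/-- Boundary bumping: a component of the part of a continuum in a cell reaches the boundary of
the cell, unless the whole continuum lies in the cell. -/
lemma subset_signCell_of_connectedComponentIn_disjoint {X ι : Type*} [TopologicalSpace X]
    [T2Space X] [Finite ι] {f : ι → X → ℝ} (hf : ∀ i, Continuous (f i)) {E : Set X}
    (hcomp : IsCompact E) (hconn : IsPreconnected E) (hfin : (E ∩ {z | ∃ i, f i z = 0}).Finite)
    (s : Set ι) {x : X} (hx : x ∈ E ∩ signCell f s)
    (hdisj : ∀ z ∈ connectedComponentIn (E ∩ signCell f s) x, ∀ i, f i z ≠ 0) :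
    E ⊆ signCell f s := by
  set Y := E ∩ signCell f s with hY
  have hYc : IsCompact Y := hcomp.inter_right (isClosed_signCell hf s)
  have := isCompact_iff_compactSpace.mp hYc
  have hF : {y : Y | ∃ i, f i y = 0}.Finite := by
    refine Set.Finite.of_finite_image (hfin.subset ?_) (Subtype.val_injective.injOn)
    rintro _ ⟨y, hy, rfl⟩
    exact ⟨y.2.1, hy⟩
  have hsep : ∀ y ∈ {y : Y | ∃ i, f i y = 0}, ∃ U : Set Y, IsClopen U ∧ ⟨x, hx⟩ ∈ U ∧ y ∉ U := by
    rintro y ⟨i, hi⟩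
    have hy : y ∉ connectedComponent (⟨x, hx⟩ : Y) := fun hy ↦
      hdisj y (by rw [connectedComponentIn_eq_image hx]; exact ⟨y, hy, rfl⟩) i hi
    rw [connectedComponent_eq_iInter_isClopen, Set.mem_iInter, not_forall] at hy
    obtain ⟨⟨U, hU⟩, hyU⟩ := hy
    exact ⟨U, hU.1, hU.2, hyU⟩
  choose! U hUclopen hxU hyU using hsep
  have hV := hF.isClopen_biInter hUclopen
  set V : Set Y := ⋂ y ∈ {y : Y | ∃ i, f i y = 0}, U y
  have hVne : ∀ y ∈ V, ∀ i, f i y ≠ 0 := fun y hy i hi ↦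
    hyU y ⟨i, hi⟩ (Set.mem_iInter₂.mp hy y ⟨i, hi⟩)
  set A : Set X := Subtype.val '' V
  set B : Set X := Subtype.val '' Vᶜ ∪ ⋃ i, {z | (i ∈ s → f i z ≤ 0) ∧ (i ∉ s → 0 ≤ f i z)}
  have hA : IsClosed A := (hV.isClosed.isCompact.image continuous_subtype_val).isClosed
  have hB : IsClosed B := by
    refine (hV.compl.isClosed.isCompact.image continuous_subtype_val).isClosed.union
      (isClosed_iUnion_of_finite fun i ↦ ?_)
    by_cases hi : i ∈ s
    · simpa [hi] using isClosed_le (hf i) continuous_const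
    · simpa [hi] using isClosed_le continuous_const (hf i)
  have hcover : E ⊆ A ∪ B := by
    intro z hz
    by_cases hzs : z ∈ signCell f s
    · by_cases hzV : (⟨z, hz, hzs⟩ : Y) ∈ V
      · exact Or.inl ⟨_, hzV, rfl⟩
      · exact Or.inr (Or.inl ⟨_, hzV, rfl⟩)
    · refine Or.inr (Or.inr (Set.mem_iUnion.mpr ?_))
      simp only [signCell, Set.mem_ofPred_eq, not_forall] at hzs
      obtain ⟨i, hi⟩ := hzs
      refine ⟨i, ?_⟩
      simp only [Set.mem_ofPred_eq]
      by_cases his : i ∈ s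
      · simp only [his, not_true_eq_false, false_implies, and_true, true_implies] at hi ⊢
        linarith
      · simp only [his, not_false_eq_true, false_implies, true_and, true_implies] at hi ⊢
        linarith
  have hAB : ¬ (E ∩ (A ∩ B)).Nonempty := by
    rintro ⟨_, -, ⟨y, hyV, rfl⟩, ⟨y', hy', hyy'⟩ | hy⟩
    · exact hy' (Subtype.val_injective hyy' ▸ hyV)
    · obtain ⟨i, hi⟩ := Set.mem_iUnion.mp hy
      refine hVne y hyV i ?_
      by_cases his : i ∈ s
      · exact le_antisymm (hi.1 his) ((y.2.2 i).1 his)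
      · exact le_antisymm ((y.2.2 i).2 his) (hi.2 his)
  have hEB : ¬ (E ∩ B).Nonempty := fun h ↦ hAB <|
    isPreconnected_closed_iff.mp hconn A B hA hB hcover
      ⟨x, hx.1, ⟨x, hx⟩, Set.mem_iInter₂.mpr fun y hy ↦ hxU y hy, rfl⟩ h
  intro z hz
  rcases hcover hz with ⟨y, -, rfl⟩ | hzB
  · exact y.2.2
  · exact (hEB ⟨z, hz, hzB⟩).elim

/-- A continuum which finitely many level sets cut in finitely many points is a finite union of
continua, on each of which no level function changes sign, overlapping only in the cut points. -/
lemma exists_finite_cover_of_finite_zeros {X ι : Type*} [TopologicalSpace X]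
    [T2Space X] [Finite ι] {f : ι → X → ℝ} (hf : ∀ i, Continuous (f i)) {E : Set X}
    (hcomp : IsCompact E) (hconn : IsPreconnected E)
    (hfin : (E ∩ {z | ∃ i, f i z = 0}).Finite) :
    ∃ 𝒞 : Set (Set X), 𝒞.Finite ∧ E ⊆ ⋃₀ 𝒞 ∧
      (∀ C ∈ 𝒞, C ⊆ E ∧ C.Nonempty ∧ IsCompact C ∧ IsPreconnected C ∧
        ∀ x ∈ C, ∀ y ∈ C, ∀ i, 0 ≤ f i x * f i y) ∧
      ∀ C ∈ 𝒞, ∀ D ∈ 𝒞, C ≠ D → C ∩ D ⊆ {z | ∃ i, f i z = 0} := by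
  set comp : Set ι → X → Set X := fun s x ↦ connectedComponentIn (E ∩ signCell f s) x
  refine ⟨{C | ∃ s, ∃ x ∈ E ∩ signCell f s, comp s x = C}, ?_, ?_, ?_, ?_⟩
  · refine ((Set.finite_singleton E).union
      (Set.finite_iUnion fun s ↦ hfin.image (comp s))).subset ?_
    rintro _ ⟨s, x, hx, rfl⟩
    by_cases h : ∀ z ∈ comp s x, ∀ i, f i z ≠ 0
    · left
      have hsub := subset_signCell_of_connectedComponentIn_disjoint hf hcomp hconn hfin s hx h
      have hE : E ∩ signCell f s = E := Set.inter_eq_left.mpr hsub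
      simp only [comp, hE, Set.mem_singleton_iff]
      exact (connectedComponentIn_subset E x).antisymm
        (hconn.subset_connectedComponentIn hx.1 subset_rfl)
    · push Not at h
      obtain ⟨z, hz, i, hi⟩ := h
      exact Or.inr (Set.mem_iUnion.mpr ⟨s, z, ⟨(connectedComponentIn_subset _ _ hz).1, i, hi⟩,
        (connectedComponentIn_eq hz).symm⟩)
  · intro z hz
    have hz' : z ∈ E ∩ signCell f {i | 0 ≤ f i z} := ⟨hz, mem_signCell_setOf f z⟩
    exact ⟨_, ⟨_, z, hz', rfl⟩, mem_connectedComponentIn hz'⟩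
  · rintro _ ⟨s, x, hx, rfl⟩
    have hsub : comp s x ⊆ E ∩ signCell f s := connectedComponentIn_subset _ _
    refine ⟨fun z hz ↦ (hsub hz).1, ⟨x, mem_connectedComponentIn hx⟩,
      (hcomp.inter_right (isClosed_signCell hf s)).connectedComponentIn x,
      isPreconnected_connectedComponentIn, fun y hy z hz i ↦ ?_⟩
    by_cases hi : i ∈ s
    · exact mul_nonneg (((hsub hy).2 i).1 hi) (((hsub hz).2 i).1 hi)
    · exact mul_nonneg_of_nonpos_of_nonpos (((hsub hy).2 i).2 hi) (((hsub hz).2 i).2 hi)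
  · rintro _ ⟨s, x, hx, rfl⟩ _ ⟨t, y, hy, rfl⟩ hne z ⟨hzs, hzt⟩
    have hst : s ≠ t := by
      rintro rfl
      exact hne ((connectedComponentIn_eq hzs).trans (connectedComponentIn_eq hzt).symm)
    have hzs' := (connectedComponentIn_subset _ _ hzs).2
    have hzt' := (connectedComponentIn_subset _ _ hzt).2
    obtain ⟨i, hi⟩ : ∃ i, ¬ (i ∈ s ↔ i ∈ t) := by
      by_contra! h
      exact hst (Set.ext h)
    refine ⟨i, ?_⟩
    by_cases his : i ∈ s
    · have hit : i ∉ t := fun h ↦ hi ⟨fun _ ↦ h, fun _ ↦ his⟩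
      exact le_antisymm ((hzt' i).2 hit) ((hzs' i).1 his)
    · have hit : i ∈ t := by
        by_contra h
        exact hi ⟨fun h' ↦ absurd h' his, fun h' ↦ absurd h' h⟩
      exact le_antisymm ((hzs' i).2 his) ((hzt' i).1 hit)

lemma exists_lineProj_ne_zero {w : ℂ} (hw : w ≠ 0) :
    ∃ θ ∈ Set.Ioo 0 Real.pi, lineProj θ w ≠ 0 := by
  by_contra! h
  have h1 := h (Real.pi / 2) ⟨by positivity, by linarith [Real.pi_pos]⟩
  have h2 := h (Real.pi / 4) ⟨by positivity, by linarith [Real.pi_pos]⟩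
  simp only [lineProj_apply, Real.cos_pi_div_two, zero_mul, Real.sin_pi_div_two, one_mul,
    zero_add] at h1
  simp only [lineProj_apply, h1, Real.cos_pi_div_four, mul_zero, add_zero] at h2
  refine hw (Complex.ext ?_ h1)
  have : (√2 / 2 : ℝ) ≠ 0 := by positivity
  exact (mul_eq_zero.mp h2).resolve_left this

lemma exists_separating_line {P : ℝ × ℝ → Prop}
    (hP : ∀ᵐ q : ℝ × ℝ, q.1 ∈ Set.Ico 0 Real.pi → P q) {x y : ℂ} (hxy : x ≠ y) :
    ∃ q, P q ∧ (lineProj q.1 x - q.2) * (lineProj q.1 y - q.2) < 0 := by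
  obtain ⟨θ, hθ, hθne⟩ := exists_lineProj_ne_zero (sub_ne_zero.mpr hxy)
  have hcont : Continuous fun q : ℝ × ℝ ↦
      (lineProj q.1 x - q.2) * (lineProj q.1 y - q.2) := by
    simp only [lineProj_apply]
    fun_prop
  set O : Set (ℝ × ℝ) := {q | q.1 ∈ Set.Ioo 0 Real.pi ∧
    (lineProj q.1 x - q.2) * (lineProj q.1 y - q.2) < 0}
  have hO : IsOpen O := (isOpen_Ioo.preimage continuous_fst).inter
    (isOpen_lt hcont continuous_const)
  have hOne : O.Nonempty := by
    refine ⟨(θ, (lineProj θ x + lineProj θ y) / 2), hθ, ?_⟩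
    rw [map_sub] at hθne
    have := sq_pos_of_ne_zero hθne
    show (lineProj θ x - (lineProj θ x + lineProj θ y) / 2) *
      (lineProj θ y - (lineProj θ x + lineProj θ y) / 2) < 0
    nlinarith
  obtain ⟨q, hqO, hq⟩ := (Measure.dense_of_ae hP).inter_open_nonempty O hO hOne
  exact ⟨q, hq (Set.Ioo_subset_Ico_self hqO.1), hqO.2⟩

/-- Almost every line being admissible, finitely many admissible lines separate all pairs of
points of a compact set at distance at least `δ`. -/
lemma exists_finite_separating_lines {E : Set ℂ} (hcomp : IsCompact E) {P : ℝ × ℝ → Prop}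
    (hP : ∀ᵐ q : ℝ × ℝ, q.1 ∈ Set.Ico 0 Real.pi → P q) {δ : ℝ} (hδ : 0 < δ) :
    ∃ T : Finset (ℝ × ℝ), (∀ q ∈ T, P q) ∧ ∀ x ∈ E, ∀ y ∈ E, δ ≤ dist x y →
      ∃ q ∈ T, (lineProj q.1 x - q.2) * (lineProj q.1 y - q.2) < 0 := by
  classical
  have hK : IsCompact ((E ×ˢ E) ∩ {w | δ ≤ dist w.1 w.2}) :=
    (hcomp.prod hcomp).inter_right (isClosed_le continuous_const continuous_dist)
  let O : {q // P q} → Set (ℂ × ℂ) := fun q ↦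
    {w | (lineProj q.1.1 w.1 - q.1.2) * (lineProj q.1.1 w.2 - q.1.2) < 0}
  have hO : ∀ q, IsOpen (O q) := fun q ↦ isOpen_lt (by fun_prop) continuous_const
  have hcover : (E ×ˢ E) ∩ {w | δ ≤ dist w.1 w.2} ⊆ ⋃ q, O q := by
    rintro ⟨x, y⟩ ⟨-, hxy⟩
    have hne : x ≠ y := dist_pos.mp (hδ.trans_le hxy)
    obtain ⟨q, hq, hlt⟩ := exists_separating_line hP hne
    exact Set.mem_iUnion.mpr ⟨⟨q, hq⟩, hlt⟩
  obtain ⟨t, ht⟩ := hK.elim_finite_subcover O hO hcover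
  refine ⟨t.image Subtype.val, fun q hq ↦ ?_, fun x hx y hy hxy ↦ ?_⟩
  · obtain ⟨q', -, rfl⟩ := Finset.mem_image.mp hq
    exact q'.2
  · have hmem : (x, y) ∈ (E ×ˢ E) ∩ {w | δ ≤ dist w.1 w.2} := ⟨⟨hx, hy⟩, hxy⟩
    obtain ⟨q, hqt, hq⟩ := Set.mem_iUnion₂.mp (ht hmem)
    exact ⟨q, Finset.mem_image_of_mem _ hqt, hq⟩

/-- If finitely many continua in `E` overlap in finitely many points, and almost every line
orthogonal to the direction `θ` meets `E` in at most `N` points, then the lengths of the shadows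
of the continua add up to at most `N` times the length of the shadow of `E`. -/
lemma sum_volume_lineProj_image_le {E F : Set ℂ} (hcomp : IsCompact E) (hF : F.Finite) {N : ℕ}
    {θ : ℝ}
    (hlines : ∀ᵐ c : ℝ, {z ∈ E | lineProj θ z = c}.encard ≤ N) (𝒞 : Finset (Set ℂ))
    (hsub : ∀ C ∈ 𝒞, C ⊆ E) (hcpt : ∀ C ∈ 𝒞, IsCompact C)
    (hinter : ∀ C ∈ 𝒞, ∀ D ∈ 𝒞, C ≠ D → C ∩ D ⊆ F) :
    ∑ C ∈ 𝒞, volume (lineProj θ '' C) ≤ N * volume (lineProj θ '' E) := by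
  classical
  have hmeas : ∀ {C : Set ℂ}, IsCompact C → MeasurableSet (lineProj θ '' C) := fun hC ↦
    (hC.image (lineProj θ).continuous).measurableSet
  calc ∑ C ∈ 𝒞, volume (lineProj θ '' C)
      = ∫⁻ c, ∑ C ∈ 𝒞, (lineProj θ '' C).indicator 1 c := by
        rw [lintegral_finsetSum' _ fun C hC ↦
          (measurable_one.indicator (hmeas (hcpt C hC))).aemeasurable]
        exact Finset.sum_congr rfl fun C hC ↦ (lintegral_indicator_one (hmeas (hcpt C hC))).symm
    _ ≤ ∫⁻ c, N * (lineProj θ '' E).indicator 1 c := by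
        refine lintegral_mono_ae ?_
        have hFnull : ∀ᵐ c : ℝ, c ∉ lineProj θ '' F :=
          (hF.image (lineProj θ)).measure_zero volume |> measure_eq_zero_iff_ae_notMem.mp
        filter_upwards [hlines, hFnull] with c hc hcF
        simp only [Set.indicator_apply, Pi.one_apply, Finset.sum_boole]
        by_cases hcE : c ∈ lineProj θ '' E
        · rw [if_pos hcE, mul_one]
          have hz : ∀ C ∈ 𝒞.filter (c ∈ lineProj θ '' ·), ∃ z ∈ C, lineProj θ z = c :=
            fun C hC ↦ (Finset.mem_filter.mp hC).2
          choose! z hzC hzc using hz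
          have hinj : Set.InjOn z (𝒞.filter (c ∈ lineProj θ '' ·)) := by
            intro C hC D hD hCD
            by_contra hne
            refine hcF ⟨z C, hinter C (Finset.mem_filter.mp hC).1 D (Finset.mem_filter.mp hD).1
              hne ⟨hzC C hC, ?_⟩, hzc C hC⟩
            rw [hCD]
            exact hzC D hD
          have hle := (Set.encard_le_encard (s := z '' (𝒞.filter (c ∈ lineProj θ '' ·)))
            (t := {z ∈ E | lineProj θ z = c}) (by
              rintro _ ⟨C, hC, rfl⟩
              exact ⟨hsub C (Finset.mem_filter.mp hC).1 (hzC C hC), hzc C hC⟩)).trans hc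
          rw [hinj.encard_image, Set.encard_coe_eq_coe_finsetCard] at hle
          exact_mod_cast hle
        · have hempty : 𝒞.filter (c ∈ lineProj θ '' ·) = ∅ :=
            Finset.filter_false_of_mem fun C hC h ↦ hcE (Set.image_mono (hsub C hC) h)
          rw [hempty, if_neg hcE]
          simp
    _ = N * volume (lineProj θ '' E) := by
        rw [lintegral_const_mul' _ _ (ENNReal.natCast_ne_top N),
          lintegral_indicator_one (hmeas hcomp)]

lemma IsCompact.exists_edist_eq_ediam {X : Type*} [PseudoEMetricSpace X] {s : Set X}
    (hs : IsCompact s) (hne : s.Nonempty) :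
    ∃ x ∈ s, ∃ y ∈ s, edist x y = Metric.ediam s := by
  obtain ⟨⟨x, y⟩, ⟨hx, hy⟩, hmax⟩ := (hs.prod hs).exists_isMaxOn (hne.prod hne)
    (continuous_edist (α := X)).continuousOn
  exact ⟨x, hx, y, hy, (Metric.edist_le_ediam_of_mem hx hy).antisymm
    (Metric.ediam_le fun a ha b hb ↦ hmax (show (a, b) ∈ s ×ˢ s from ⟨ha, hb⟩))⟩

lemma exists_norm_eq_ediam_of_isPreconnected {C : Set ℂ} (hne : C.Nonempty) (hcpt : IsCompact C)
    (hconn : IsPreconnected C) :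
    ∃ w : ℂ, Metric.ediam C = ENNReal.ofReal ‖w‖ ∧
      ∀ θ, ENNReal.ofReal |lineProj θ w| ≤ volume (lineProj θ '' C) := by
  obtain ⟨x, hx, y, hy, hxy⟩ := hcpt.exists_edist_eq_ediam hne
  refine ⟨x - y, by rw [← hxy, edist_dist, dist_eq_norm], fun θ ↦ ?_⟩
  have hord := (hconn.image (lineProj θ) (lineProj θ).continuous.continuousOn).ordConnected
  rw [map_sub, ← Real.volume_interval]
  exact measure_mono (hord.uIcc_subset ⟨y, hy, rfl⟩ ⟨x, hx, rfl⟩)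

/-- If almost every line meets the continuum `E` in at most `2 d` points, the length of `E` is at
most `d` times the integral of the lengths of its shadows. -/
lemma hausdorffMeasure_le_lintegral_volume_lineProj {E : Set ℂ} (hcomp : IsCompact E)
    (hconn : IsPreconnected E) {d : ℕ}
    (hlines : ∀ᵐ q : ℝ × ℝ, q.1 ∈ Set.Ico 0 Real.pi →
      {z ∈ E | lineProj q.1 z = q.2}.encard ≤ (2 * d : ℕ)) :
    μH[1] E ≤ d * ∫⁻ θ in Set.Ico 0 Real.pi, volume (lineProj θ '' E) := by
  have hcover : ∀ δ : ℝ, 0 < δ → ∃ 𝒞 : Finset (Set ℂ),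
      (∀ C ∈ 𝒞, Metric.ediam C ≤ ENNReal.ofReal δ) ∧ E ⊆ ⋃ C : 𝒞, (C : Set ℂ) ∧
      ∑ C : 𝒞, Metric.ediam (C : Set ℂ) ≤
        d * ∫⁻ θ in Set.Ico 0 Real.pi, volume (lineProj θ '' E) := by
    intro δ hδ
    obtain ⟨T, hTfin, hTsep⟩ := exists_finite_separating_lines hcomp hlines hδ
    let f : T → ℂ → ℝ := fun q z ↦ lineProj q.1.1 z - q.1.2
    have hf : ∀ q, Continuous (f q) := fun q ↦ by fun_prop
    have hfin : (E ∩ {z | ∃ q, f q z = 0}).Finite := by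
      refine (Set.finite_iUnion fun q : T ↦
        (Set.finite_of_encard_le_coe (hTfin q.1 q.2))).subset ?_
      rintro z ⟨hzE, q, hq⟩
      exact Set.mem_iUnion.mpr ⟨q, hzE, sub_eq_zero.mp hq⟩
    obtain ⟨𝒞, h𝒞, hE, hC, hinter⟩ := exists_finite_cover_of_finite_zeros hf hcomp hconn hfin
    lift 𝒞 to Finset (Set ℂ) using h𝒞
    refine ⟨𝒞, fun C hCm ↦ Metric.ediam_le fun x hx y hy ↦ ?_, ?_, ?_⟩
    · obtain ⟨hCE, -, -, -, hsign⟩ := hC C hCm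
      rw [edist_dist]
      refine ENNReal.ofReal_le_ofReal (le_of_not_gt fun hlt ↦ ?_)
      obtain ⟨q, hq, hneg⟩ := hTsep x (hCE hx) y (hCE hy) hlt.le
      exact (hsign x hx y hy ⟨q, hq⟩).not_gt hneg
    · rw [Set.sUnion_eq_iUnion] at hE
      exact hE
    · rw [Finset.sum_coe_sort 𝒞 Metric.ediam]
      have hw : ∀ C ∈ 𝒞, ∃ w : ℂ, Metric.ediam C = ENNReal.ofReal ‖w‖ ∧
          ∀ θ, ENNReal.ofReal |lineProj θ w| ≤ volume (lineProj θ '' C) := fun C hCm ↦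
        exists_norm_eq_ediam_of_isPreconnected (hC C hCm).2.1 (hC C hCm).2.2.1 (hC C hCm).2.2.2.1
      choose! w hwd hwθ using hw
      have hwmeas : ∀ C, Measurable fun θ ↦ ENNReal.ofReal |lineProj θ (w C)| := fun C ↦ by
        simp only [lineProj_apply]
        fun_prop
      have hae : ∀ᵐ θ ∂volume.restrict (Set.Ico 0 Real.pi),
          ∑ C ∈ 𝒞, ENNReal.ofReal |lineProj θ (w C)| ≤
            (2 * d : ℕ) * volume (lineProj θ '' E) := by
        rw [ae_restrict_iff' measurableSet_Ico]
        filter_upwards [Measure.ae_ae_of_ae_prod hlines] with θ hθ hθmem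
        refine (Finset.sum_le_sum fun C hCm ↦ hwθ C hCm θ).trans ?_
        refine sum_volume_lineProj_image_le hcomp hfin (hθ.mono fun c hc ↦ hc hθmem) 𝒞
          (fun C hCm ↦ (hC C hCm).1) (fun C hCm ↦ (hC C hCm).2.2.1)
          fun C hCm D hDm hne z hz ↦ ⟨(hC C hCm).1 hz.1, hinter C hCm D hDm hne hz⟩
      have hinterior := lintegral_mono_ae hae
      rw [lintegral_finsetSum _ fun C _ ↦ hwmeas C,
        lintegral_const_mul' _ _ (ENNReal.natCast_ne_top _)] at hinterior
      simp only [lintegral_abs_lineProj] at hinterior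
      rw [← Finset.mul_sum, Nat.cast_mul, Nat.cast_ofNat, mul_assoc,
        ENNReal.mul_le_mul_iff_right (by norm_num) (by norm_num)] at hinterior
      rwa [Finset.sum_congr rfl hwd]
  choose 𝒞 hdiam hE hsum using fun n : ℕ ↦ hcover (1 / (n + 1)) Nat.one_div_pos_of_nat
  have h := Measure.hausdorffMeasure_le_liminf_sum (ι := fun n ↦ 𝒞 n) (l := Filter.atTop) 1 E
    (fun n : ℕ ↦ ENNReal.ofReal (1 / (n + 1)))
    (by simpa using ENNReal.tendsto_ofReal tendsto_one_div_add_atTop_nhds_zero_nat)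
    (fun n C ↦ (C : Set ℂ)) (Filter.Eventually.of_forall fun n C ↦ hdiam n C C.2)
    (Filter.Eventually.of_forall hE)
  refine h.trans (Filter.liminf_le_of_frequently_le' (Filter.Frequently.of_forall fun n ↦ ?_))
  simpa only [ENNReal.rpow_one] using hsum n

lemma exists_mem_frontier_lineProj_ge {K : Set ℂ} (hK : IsCompact K) (θ : ℝ) {x : ℂ}
    (hx : x ∈ K) : ∃ y ∈ frontier K, lineProj θ x ≤ lineProj θ y := by
  obtain ⟨y, hy, hmax⟩ := hK.exists_isMaxOn ⟨x, hx⟩ (lineProj θ).continuous.continuousOn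
  refine ⟨y, ?_, hmax hx⟩
  rw [hK.isClosed.frontier_eq]
  refine ⟨hy, fun hinterior ↦ ?_⟩
  set u : ℂ := ⟨Real.cos θ, Real.sin θ⟩
  have hu : lineProj θ u = 1 := by
    rw [lineProj_apply]
    linear_combination Real.sin_sq_add_cos_sq θ
  have htend : Filter.Tendsto (fun t : ℝ ↦ y + t • u) (nhdsWithin 0 (Set.Ioi 0)) (nhds y) :=
    tendsto_nhdsWithin_of_tendsto_nhds
      ((by fun_prop : Continuous fun t : ℝ ↦ y + t • u).tendsto' 0 y (by simp))
  obtain ⟨t, htK, ht⟩ := ((htend.eventually (mem_interior_iff_mem_nhds.mp hinterior)).and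
    self_mem_nhdsWithin).exists
  have hle : lineProj θ (y + t • u) ≤ lineProj θ y := hmax htK
  rw [map_add, map_smul, hu, smul_eq_mul, mul_one] at hle
  have ht' : 0 < t := ht
  linarith

lemma lineProj_add_pi (θ : ℝ) (z : ℂ) : lineProj (θ + Real.pi) z = -lineProj θ z := by
  simp only [lineProj_apply, Real.cos_add_pi, Real.sin_add_pi]
  ring

/-- The boundary of a planar convex body is a Jordan curve. -/
lemma exists_param_frontier {K : Set ℂ} (hconv : Convex ℝ K) (hK : IsCompact K)
    (hinterior : (interior K).Nonempty) :
    ∃ γ : ℝ → ℂ, Continuous γ ∧ γ 0 = γ (2 * Real.pi) ∧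
      Set.InjOn γ (Set.Ico 0 (2 * Real.pi)) ∧ γ '' Set.Ico 0 (2 * Real.pi) = frontier K := by
  obtain ⟨h, -, -, hfr⟩ :=
    exists_homeomorph_image_interior_closure_frontier_eq_unitBall hconv hinterior hK.isBounded
  refine ⟨fun t ↦ h.symm (Circle.exp t), by fun_prop, ?_, ?_, ?_⟩
  · simp
  · intro s hs t ht hst
    exact Circle.exp_injOn_Ico (by simp) hs ht (Subtype.val_injective (h.symm.injective hst))
  · ext z
    have hz : z ∈ frontier K ↔ h z ∈ Metric.sphere (0 : ℂ) 1 := by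
      rw [← hfr, h.injective.mem_set_image]
    rw [hz]
    constructor
    · rintro ⟨t, -, rfl⟩
      simp
    · intro hz
      obtain ⟨t, ht⟩ := Circle.exp_surjective ⟨h z, hz⟩
      obtain ⟨s, hs, hst⟩ := Circle.periodic_exp.exists_mem_Ico₀ Real.two_pi_pos t
      refine ⟨s, hs, ?_⟩
      rw [h.symm_apply_eq, ← hst, ht]

/-- A closed polygon runs at least twice along the distance between any two of its vertices. -/
lemma two_mul_dist_le_sum_dist_of_closed {α : Type*} [PseudoMetricSpace α] {a : ℕ → α} {n : ℕ}
    (hclosed : a 0 = a n) {j k : ℕ} (hj : j ≤ n) (hk : k ≤ n) :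
    2 * dist (a j) (a k) ≤ ∑ i ∈ Finset.range n, dist (a i) (a (i + 1)) := by
  wlog hjk : j ≤ k generalizing j k
  · rw [dist_comm]
    exact this hk hj (le_of_not_ge hjk)
  have h1 := dist_le_Ico_sum_dist a hjk
  have h2 := dist_le_Ico_sum_dist a (zero_le : 0 ≤ j)
  have h3 := dist_le_Ico_sum_dist a hk
  have h4 := Finset.sum_Ico_consecutive (fun i ↦ dist (a i) (a (i + 1))) (zero_le : 0 ≤ j) hjk
  have h5 := Finset.sum_Ico_consecutive (fun i ↦ dist (a i) (a (i + 1))) (zero_le : 0 ≤ k) hk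
  have h6 := dist_triangle (a j) (a 0) (a k)
  rw [Finset.range_eq_Ico]
  rw [dist_comm (a j) (a 0)] at h6
  rw [← hclosed, dist_comm (a k)] at h3
  linarith

lemma ofReal_dist_le_hausdorffMeasure_image_Ico {X : Type*} [MetricSpace X] [MeasurableSpace X]
    [BorelSpace X] {γ : ℝ → X} {a b : ℝ} (hab : a ≤ b) (hγ : ContinuousOn γ (Set.Icc a b)) :
    ENNReal.ofReal (dist (γ a) (γ b)) ≤ μH[1] (γ '' Set.Ico a b) := by
  have hlip : LipschitzWith 1 (dist (γ a)) := LipschitzWith.dist_right _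
  have hle := hlip.hausdorffMeasure_image_le (zero_le_one (α := ℝ)) (γ '' Set.Ico a b)
  rw [hausdorffMeasure_real, ENNReal.coe_one, ENNReal.one_rpow, one_mul, ← Set.image_comp] at hle
  refine le_trans ?_ hle
  have hivt := intermediate_value_Ico hab (hlip.continuous.comp_continuousOn hγ)
  refine le_trans (le_of_eq ?_) (measure_mono hivt)
  simp

/-- The polygon inscribed in a simple arc is no longer than the arc. -/
lemma sum_ofReal_dist_le_hausdorffMeasure_image_Ico {X : Type*} [MetricSpace X]
    [MeasurableSpace X] [BorelSpace X] {γ : ℝ → X} (hγ : Continuous γ) {t : ℕ → ℝ}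
    (ht : Monotone t) (n : ℕ) (hinj : Set.InjOn γ (Set.Ico (t 0) (t n))) :
    ∑ i ∈ Finset.range n, ENNReal.ofReal (dist (γ (t i)) (γ (t (i + 1)))) ≤
      μH[1] (γ '' Set.Ico (t 0) (t n)) := by
  induction n with
  | zero => simp
  | succ n ih =>
    have hunion : Set.Ico (t 0) (t (n + 1)) = Set.Ico (t 0) (t n) ∪ Set.Ico (t n) (t (n + 1)) :=
      (Set.Ico_union_Ico_eq_Ico (ht zero_le) (ht n.le_succ)).symm
    have hsub : Set.Ico (t n) (t (n + 1)) ⊆ Set.Ico (t 0) (t (n + 1)) :=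
      hunion ▸ Set.subset_union_right
    have hsub' : Set.Ico (t 0) (t n) ⊆ Set.Ico (t 0) (t (n + 1)) :=
      hunion ▸ Set.subset_union_left
    rw [Finset.sum_range_succ, hunion, Set.image_union, measure_union]
    · exact add_le_add (ih (hinj.mono hsub'))
        (ofReal_dist_le_hausdorffMeasure_image_Ico (ht n.le_succ) hγ.continuousOn)
    · refine Set.disjoint_image_image fun x hx y hy hxy ↦ ?_
      have := hinj (hsub' hx) (hsub hy) hxy
      linarith [hx.2, hy.1]
    · exact measurableSet_Ico.image_of_continuousOn_injOn hγ.continuousOn (hinj.mono hsub)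

/-- Cauchy's formula, as an inequality: the perimeter of a planar convex body is at least the
integral of the lengths of its shadows. -/
lemma lintegral_volume_lineProj_le_hausdorffMeasure_frontier {K : Set ℂ} (hconv : Convex ℝ K)
    (hK : IsCompact K) (hinterior : (interior K).Nonempty) :
    ∫⁻ θ in Set.Ico 0 Real.pi, volume (lineProj θ '' K) ≤ μH[1] (frontier K) := by
  obtain ⟨γ, hγ, hclosed, hinj, himage⟩ := exists_param_frontier hconv hK hinterior
  have hpi := Real.pi_pos
  have hbound : ∀ ε : ℝ, 0 < ε → ∫⁻ θ in Set.Ico 0 Real.pi, volume (lineProj θ '' K) ≤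
      μH[1] (frontier K) + ENNReal.ofReal (2 * ε * Real.pi) := by
    intro ε hε
    obtain ⟨δ, hδ, hunif⟩ := Metric.uniformContinuousOn_iff.mp
      (isCompact_Icc.uniformContinuousOn_of_continuous
        (hγ.continuousOn (s := Set.Icc 0 (2 * Real.pi)))) ε hε
    obtain ⟨n, hn⟩ := exists_nat_gt (2 * Real.pi / δ)
    have hn0 : (0 : ℝ) < n := lt_trans (by positivity) hn
    set t : ℕ → ℝ := fun i ↦ i * (2 * Real.pi / n)
    have htmono : Monotone t := fun i j hij ↦ by
      have : (i : ℝ) ≤ j := by exact_mod_cast hij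
      exact mul_le_mul_of_nonneg_right this (by positivity)
    have ht0 : t 0 = 0 := by simp [t]
    have htn : t n = 2 * Real.pi := by simp only [t]; field_simp
    have hstep : 2 * Real.pi / n < δ := by
      rw [div_lt_iff₀ hδ] at hn
      rw [div_lt_iff₀ hn0]
      linarith
    have hnear : ∀ z ∈ frontier K, ∃ j ≤ n, dist z (γ (t j)) < ε := by
      rw [← himage]
      rintro _ ⟨s, hs, rfl⟩
      have hnonneg : 0 ≤ s / (2 * Real.pi / n) := div_nonneg hs.1 (by positivity)
      have hfl := Nat.floor_le hnonneg
      have hfl' := Nat.lt_floor_add_one (s / (2 * Real.pi / n))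
      rw [le_div_iff₀ (by positivity)] at hfl
      rw [div_lt_iff₀ (by positivity)] at hfl'
      set j := ⌊s / (2 * Real.pi / n)⌋₊
      have hj : j ≤ n := by
        by_contra! hlt
        have := htmono hlt.le
        rw [htn] at this
        exact (this.trans hfl).not_gt hs.2
      refine ⟨j, hj, hunif s (Set.Ico_subset_Icc_self hs) (t j)
        ⟨ht0 ▸ htmono zero_le, htn ▸ htmono hj⟩ ?_⟩
      rw [Real.dist_eq, abs_of_nonneg (sub_nonneg.mpr hfl)]
      linarith
    have hwidth : ∀ θ, volume (lineProj θ '' K) ≤ ENNReal.ofReal 2⁻¹ *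
        ∑ i ∈ Finset.range n, ENNReal.ofReal |lineProj θ (γ (t i) - γ (t (i + 1)))| +
          ENNReal.ofReal (2 * ε) := by
      intro θ
      rw [← ENNReal.ofReal_sum_of_nonneg fun _ _ ↦ abs_nonneg _,
        ← ENNReal.ofReal_mul (by norm_num), ← ENNReal.ofReal_add (by positivity) (by positivity)]
      refine (Real.volume_le_diam _).trans (Metric.ediam_le ?_)
      have hdiff : ∀ x ∈ K, ∀ y ∈ K, lineProj θ x - lineProj θ y ≤
          2⁻¹ * ∑ i ∈ Finset.range n, |lineProj θ (γ (t i) - γ (t (i + 1)))| + 2 * ε := by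
        intro x hx y hy
        obtain ⟨x', hx', hxx'⟩ := exists_mem_frontier_lineProj_ge hK θ hx
        obtain ⟨y', hy', hyy'⟩ := exists_mem_frontier_lineProj_ge hK (θ + Real.pi) hy
        rw [lineProj_add_pi, lineProj_add_pi, neg_le_neg_iff] at hyy'
        obtain ⟨j, hj, hjx⟩ := hnear x' hx'
        obtain ⟨k, hk, hky⟩ := hnear y' hy'
        have hsum := two_mul_dist_le_sum_dist_of_closed (a := fun i ↦ lineProj θ (γ (t i)))
          (n := n) (by simp only [ht0, htn, hclosed]) hj hk
        simp only [Real.dist_eq, ← map_sub] at hsum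
        have h1 := (le_abs_self _).trans (abs_lineProj_le θ (x' - γ (t j)))
        have h2 := (neg_le_abs _).trans (abs_lineProj_le θ (y' - γ (t k)))
        have h3 := le_abs_self (lineProj θ (γ (t j) - γ (t k)))
        rw [dist_eq_norm] at hjx hky
        simp only [map_sub] at h1 h2 h3 hsum ⊢
        linarith
      rintro _ ⟨x, hx, rfl⟩ _ ⟨y, hy, rfl⟩
      rw [edist_dist, Real.dist_eq]
      refine ENNReal.ofReal_le_ofReal (abs_le.mpr ⟨?_, hdiff x hx y hy⟩)
      linarith [hdiff y hy x hx]
    have hmeas : ∀ w, Measurable fun θ ↦ ENNReal.ofReal |lineProj θ w| := fun w ↦ by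
      simp only [lineProj_apply]
      fun_prop
    calc ∫⁻ θ in Set.Ico 0 Real.pi, volume (lineProj θ '' K)
        ≤ ∫⁻ θ in Set.Ico 0 Real.pi, (ENNReal.ofReal 2⁻¹ *
            ∑ i ∈ Finset.range n, ENNReal.ofReal |lineProj θ (γ (t i) - γ (t (i + 1)))| +
              ENNReal.ofReal (2 * ε)) := lintegral_mono hwidth
      _ = ∑ i ∈ Finset.range n, ENNReal.ofReal (dist (γ (t i)) (γ (t (i + 1)))) +
            ENNReal.ofReal (2 * ε * Real.pi) := by
          rw [lintegral_add_right _ measurable_const, lintegral_const_mul' _ _ (by simp),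
            lintegral_finsetSum _ fun i _ ↦ hmeas _]
          simp only [lintegral_abs_lineProj, dist_eq_norm]
          rw [← Finset.mul_sum, ← mul_assoc, lintegral_const, Measure.restrict_apply_univ,
            Real.volume_Ico, sub_zero, ← ENNReal.ofReal_mul (by positivity),
            ENNReal.ofReal_inv_of_pos (by norm_num), ENNReal.ofReal_ofNat,
            ENNReal.inv_mul_cancel (by norm_num) (by norm_num), one_mul]
      _ ≤ μH[1] (frontier K) + ENNReal.ofReal (2 * ε * Real.pi) := by
          refine add_le_add_left ?_ _
          rw [← himage, ← htn, ← ht0]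
          exact sum_ofReal_dist_le_hausdorffMeasure_image_Ico hγ htmono n
            (by rw [ht0, htn]; exact hinj)
  refine ENNReal.le_of_forall_pos_le_add fun ε hε _ ↦ ?_
  have hε' : (0 : ℝ) < ε := hε
  refine (hbound (ε / (2 * Real.pi)) (by positivity)).trans (le_of_eq ?_)
  rw [show 2 * ((ε : ℝ) / (2 * Real.pi)) * Real.pi = ε by field_simp, ENNReal.ofReal_coe_nnreal]

/-- **Integral-geometric estimate.** Let `E ⊂ ℂ` be compact and connected, and `d ≥ 1`.
If, for almost every line `{z : Re(z·e^{-iθ}) = x}` (with respect to the kinematic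
measure `dx dθ`, `θ ∈ [0, π)`, `x ∈ ℝ`), the line meets `E` in at most `2d` points, then
the length of `E` is at most `d` times the perimeter of the convex hull of `E`. -/
theorem length_le_perimeter_convexHull (d : ℕ) (hd : 1 ≤ d) (E : Set ℂ)
    (hcomp : IsCompact E) (hconn : IsConnected E)
    (hlines : ∀ᵐ q : ℝ × ℝ, q.1 ∈ Set.Ico 0 Real.pi →
      {z ∈ E | (z * Complex.exp (-(q.1 : ℂ) * Complex.I)).re = q.2}.encard ≤ 2 * d) :
    μH[1] E ≤ d * μH[1] (frontier (convexHull ℝ E)) := by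
  rcases (interior (convexHull ℝ E)).eq_empty_or_nonempty with hempty | hinterior
  · have hsub : E ⊆ frontier (convexHull ℝ E) := by
      rw [frontier, hempty, Set.sdiff_empty]
      exact (subset_convexHull ℝ E).trans subset_closure
    have hd' : (1 : ENNReal) ≤ d := by exact_mod_cast hd
    exact (measure_mono hsub).trans (le_mul_of_one_le_left' hd')
  · have hconv := convex_convexHull ℝ E
    have hclosure := hconv.interior_closure_eq_interior_of_nonempty_interior hinterior
    have hfrontier : frontier (closure (convexHull ℝ E)) = frontier (convexHull ℝ E) := by
      rw [frontier, frontier, closure_closure, hclosure]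
    simp only [re_mul_exp_eq_lineProj] at hlines
    refine (hausdorffMeasure_le_lintegral_volume_lineProj hcomp hconn.isPreconnected
      (by exact_mod_cast hlines)).trans ?_
    rw [← hfrontier]
    gcongr
    refine (lintegral_mono fun θ ↦ ?_).trans
      (lintegral_volume_lineProj_le_hausdorffMeasure_frontier hconv.closure
        (isBounded_convexHull.mpr hcomp.isBounded).isCompact_closure (hclosure ▸ hinterior))
    exact measure_mono (Set.image_mono ((subset_convexHull ℝ E).trans subset_closure))
end
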